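/- Let n ≥ 5. For p ∈ [1, (n−1)/(n−2)) define F(p) := ∫_{ℝⁿ₊} [ (1−z_n)|z−e_n|^{−n} − (1+z_n)|z+e_n|^{−n} ] · [ (|z−e_n|^{2−n} − |z+e_n|^{2−n})ᵖ − |z−e_n|^{−(n−2)p} ] dz and G(p) := (2(n−2)/(((n−2)p−2)(n−(n−2)p))) · [ ∫_{ℝ^{n−1}} |(y,0)−e_n|^{−(n−2)(p+1)} dy − n ∫_{ℝ^{n−1}} |(y,0)−e_n|^{−((n−2)p+n)} dy ]. Then for every p ∈ [1, (n−1)/(n−2)) all of these integrals converge absolutely, and the functions p ↦ F(p) and p ↦ G(p) are continuous on the interval [1, (n−1)/(n−2)). -/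

import Mathlib

open MeasureTheory Metric Filter Topology RealInnerProductSpace

noncomputable section

abbrev Euc (n : ℕ) := EuclideanSpace ℝ (Fin n)

noncomputable def surf (n : ℕ) : Measure (Euc n) := μH[(n : ℝ) - 1]

noncomputable def omegaSph (n : ℕ) : ℝ := (surf n (sphere (0 : Euc n) 1)).toReal

/-- `c_n = 1/((n-2) ω_{n-1})`. -/
noncomputable def cGreen (n : ℕ) : ℝ := 1 / (((n : ℝ) - 2) * omegaSph n)

/-- Reflection `x ↦ x*` across the hyperplane `{x_i = 0}`. -/
noncomputable def reflct {n : ℕ} (i : Fin n) (x : Euc n) : Euc n :=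
  x - (2 * x i) • EuclideanSpace.single i 1

/-- Green function of `-Δ` on the half-space `{x_i > 0}`. -/
noncomputable def G0 (n : ℕ) (i : Fin n) (x y : Euc n) : ℝ :=
  cGreen n * (‖x - y‖ ^ ((2 : ℝ) - n) - ‖x - reflct i y‖ ^ ((2 : ℝ) - n))

/-- `α₁ = c_nᵖ/(((n-2)p-2)(n-(n-2)p))`. -/
noncomputable def alpha1 (n : ℕ) (p : ℝ) : ℝ :=
  cGreen n ^ p / ((((n : ℝ) - 2) * p - 2) * ((n : ℝ) - ((n : ℝ) - 2) * p))

lemma abs_sub_rpow_sub_rpow_le_rpow {A B p : ℝ} (hB : 0 ≤ B) (hBA : B ≤ A) (hp : 1 ≤ p) :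
    |(A - B) ^ p - A ^ p| ≤ A ^ p := by
  have h1 : 0 ≤ (A - B) ^ p := Real.rpow_nonneg (by linarith) _
  have h2 : (A - B) ^ p ≤ A ^ p :=
    Real.rpow_le_rpow (by linarith) (by linarith) (by linarith)
  rw [abs_le]
  constructor <;> linarith

lemma abs_sub_rpow_sub_rpow_le_mul {A B p : ℝ} (hA : 0 < A) (hB : 0 ≤ B) (hBA : B ≤ A)
    (hp : 1 ≤ p) : |(A - B) ^ p - A ^ p| ≤ p * A ^ (p - 1) * B := by
  have h2 : (A - B) ^ p ≤ A ^ p :=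
    Real.rpow_le_rpow (by linarith) (by linarith) (by linarith)
  have hq : B / A ≤ 1 := (div_le_one hA).2 hBA
  have h3 := one_add_mul_self_le_rpow_one_add (s := -(B / A)) (by linarith) hp
  have h4 : (A - B) ^ p = A ^ p * (1 + -(B / A)) ^ p := by
    rw [← Real.mul_rpow hA.le (by linarith)]
    congr 1
    field_simp
    ring
  have h5 : A ^ (p - 1) = A ^ p / A := Real.rpow_sub_one hA.ne' p
  have h6 : p * A ^ (p - 1) * B = A ^ p * (p * (B / A)) := by
    rw [h5]
    ring
  have h7 := mul_le_mul_of_nonneg_left h3 (Real.rpow_nonneg hA.le p)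
  rw [abs_of_nonpos (by linarith), h6, h4]
  linarith

/-- Radial majorant, uniform in `1 ≤ p ≤ p₁`, of the half-space integrand. -/
def radialMajorant (N p₁ r : ℝ) : ℝ :=
  if r ≤ 1 then 2 * p₁ * r ^ (-1 - (N - 2) * p₁) else 2 * r ^ (3 - 2 * N)

lemma abs_integrand_le_radialMajorant {N a b t p p₁ : ℝ} (hN : 5 ≤ N) (ha : 0 < a) (hab : a ≤ b)
    (hb : 1 ≤ b) (hta : |1 - t| ≤ a) (htb : |1 + t| ≤ b) (hp : 1 ≤ p) (hpp : p ≤ p₁) :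
    |((1 - t) * a ^ (-N) - (1 + t) * b ^ (-N))
      * ((a ^ (2 - N) - b ^ (2 - N)) ^ p - a ^ (-((N - 2) * p)))| ≤ radialMajorant N p₁ a := by
  have hb0 : 0 < b := ha.trans_le hab
  have hK : |(1 - t) * a ^ (-N) - (1 + t) * b ^ (-N)| ≤ 2 * a ^ (1 - N) := by
    have e1 : |(1 - t) * a ^ (-N)| ≤ a ^ (1 - N) := by
      rw [abs_mul, abs_of_pos (Real.rpow_pos_of_pos ha _), sub_eq_add_neg 1 N,
        Real.rpow_add ha, Real.rpow_one]
      gcongr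
    have e2 : |(1 + t) * b ^ (-N)| ≤ b ^ (1 - N) := by
      rw [abs_mul, abs_of_pos (Real.rpow_pos_of_pos hb0 _), sub_eq_add_neg 1 N,
        Real.rpow_add hb0, Real.rpow_one]
      gcongr
    have e3 : b ^ (1 - N) ≤ a ^ (1 - N) :=
      Real.rpow_le_rpow_of_nonpos ha hab (by linarith)
    calc _ ≤ |(1 - t) * a ^ (-N)| + |(1 + t) * b ^ (-N)| := abs_sub _ _
      _ ≤ _ := by linarith
  have hBA : b ^ (2 - N) ≤ a ^ (2 - N) :=
    Real.rpow_le_rpow_of_nonpos ha hab (by linarith)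
  have hA : 0 < a ^ (2 - N) := Real.rpow_pos_of_pos ha _
  have hB : 0 ≤ b ^ (2 - N) := (Real.rpow_pos_of_pos hb0 _).le
  have hAp : a ^ (-((N - 2) * p)) = (a ^ (2 - N)) ^ p := by
    rw [← Real.rpow_mul ha.le]
    congr 1
    ring
  rw [abs_mul, hAp]
  unfold radialMajorant
  split_ifs with h
  · have hB1 : b ^ (2 - N) ≤ 1 := Real.rpow_le_one_of_one_le_of_nonpos hb (by linarith)
    have e1 : |(a ^ (2 - N) - b ^ (2 - N)) ^ p - (a ^ (2 - N)) ^ p|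
        ≤ p₁ * a ^ ((2 - N) * (p - 1)) := by
      refine (abs_sub_rpow_sub_rpow_le_mul hA hB hBA hp).trans ?_
      rw [← Real.rpow_mul ha.le]
      have := Real.rpow_pos_of_pos ha ((2 - N) * (p - 1))
      calc p * a ^ ((2 - N) * (p - 1)) * b ^ (2 - N)
          ≤ p * a ^ ((2 - N) * (p - 1)) * 1 := by gcongr
        _ ≤ _ := by rw [mul_one]; gcongr
    calc _ ≤ 2 * a ^ (1 - N) * (p₁ * a ^ ((2 - N) * (p - 1))) := by gcongr
      _ = 2 * p₁ * a ^ (1 - N + (2 - N) * (p - 1)) := by rw [Real.rpow_add ha]; ring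
      _ ≤ _ := by
        have : a ^ (1 - N + (2 - N) * (p - 1)) ≤ a ^ (-1 - (N - 2) * p₁) :=
          Real.rpow_le_rpow_of_exponent_ge ha h (by nlinarith)
        have hp₁ : 0 ≤ p₁ := by linarith
        gcongr
  · push Not at h
    have e1 : |(a ^ (2 - N) - b ^ (2 - N)) ^ p - (a ^ (2 - N)) ^ p| ≤ a ^ (2 - N) := by
      refine (abs_sub_rpow_sub_rpow_le_rpow hB hBA hp).trans ?_
      rw [← Real.rpow_mul ha.le]
      exact Real.rpow_le_rpow_of_exponent_le h.le (by nlinarith)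
    calc _ ≤ 2 * a ^ (1 - N) * a ^ (2 - N) := by gcongr
      _ = _ := by rw [mul_assoc, ← Real.rpow_add ha]; ring_nf

lemma integrable_radialMajorant_norm {n : ℕ} (hn : 5 ≤ n) {p₁ : ℝ}
    (hp₁ : ((n : ℝ) - 2) * p₁ < (n : ℝ) - 1) :
    Integrable (fun z : Euc n => radialMajorant n p₁ ‖z‖) := by
  have hn' : (5 : ℝ) ≤ n := by exact_mod_cast hn
  have : Nonempty (Fin n) := ⟨⟨0, by omega⟩⟩
  rw [integrable_fun_norm_addHaar (μ := (volume : Measure (Euc n)))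
    (f := fun r => radialMajorant n p₁ r)]
  have hpow : ∀ y : ℝ, y ^ (n - 1) = y ^ ((n : ℝ) - 1) := fun y => by
    rw [← Real.rpow_natCast, Nat.cast_sub (by omega), Nat.cast_one]
  rw [finrank_euclideanSpace_fin, ← Set.Ioc_union_Ioi_eq_Ioi (zero_le_one' ℝ)]
  refine IntegrableOn.union ?_ ?_
  · have h := (intervalIntegral.intervalIntegrable_rpow' (a := 0) (b := 1)
      (r := (n : ℝ) - 1 + (-1 - ((n : ℝ) - 2) * p₁)) (by linarith)).const_mul (2 * p₁)
    rw [intervalIntegrable_iff_integrableOn_Ioc_of_le zero_le_one] at h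
    refine h.congr_fun (fun y hy => ?_) measurableSet_Ioc
    simp only [radialMajorant, if_pos hy.2, hpow, smul_eq_mul]
    rw [Real.rpow_add hy.1]
    ring
  · have h := (integrableOn_Ioi_rpow_of_lt (a := (n : ℝ) - 1 + (3 - 2 * n)) (c := 1)
      (by linarith) one_pos).const_mul 2
    refine IntegrableOn.congr_fun h (fun y hy => ?_) measurableSet_Ioi
    have hy' : (1 : ℝ) < y := hy
    simp only [radialMajorant, if_neg (not_le.2 hy'), hpow, smul_eq_mul]
    rw [Real.rpow_add (by linarith)]
    ring

section Hyperplane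

variable {n : ℕ} (i : Fin n)

/-- The coordinate hyperplane `{z | z i = 0}`. -/
def coordHyperplane : Submodule ℝ (Euc n) :=
  LinearMap.ker (EuclideanSpace.proj i : Euc n →L[ℝ] ℝ).toLinearMap

lemma mem_coordHyperplane {z : Euc n} : z ∈ coordHyperplane i ↔ z i = 0 := by
  simp [coordHyperplane]

lemma finrank_coordHyperplane :
    (Module.finrank ℝ (coordHyperplane i) : ℝ) = (n : ℝ) - 1 := by
  have h : (EuclideanSpace.proj i : Euc n →L[ℝ] ℝ).toLinearMap ≠ 0 := fun h => by
    simpa using LinearMap.congr_fun h (EuclideanSpace.single i (1 : ℝ))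
  have h2 := Module.Dual.finrank_ker_add_one_of_ne_zero (K := ℝ) (V₁ := Euc n) h
  rw [finrank_euclideanSpace_fin] at h2
  have h3 : Module.finrank ℝ (coordHyperplane i) + 1 = n := h2
  rw [eq_sub_iff_add_eq]
  exact_mod_cast h3

lemma norm_sub_single_sq (z : Euc n) :
    ‖z - EuclideanSpace.single i 1‖ ^ 2 = ‖z‖ ^ 2 - 2 * z i + 1 := by
  rw [norm_sub_sq_real, EuclideanSpace.inner_single_right]
  simp

lemma norm_add_single_sq (z : Euc n) :
    ‖z + EuclideanSpace.single i 1‖ ^ 2 = ‖z‖ ^ 2 + 2 * z i + 1 := by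
  rw [norm_add_sq_real, EuclideanSpace.inner_single_right]
  simp

lemma integrableOn_hyperplane_rpow {s : ℝ} (hs : (n : ℝ) - 1 < s) :
    IntegrableOn (fun y : Euc n => ‖y - EuclideanSpace.single i 1‖ ^ (-s))
      {z : Euc n | z i = 0} (surf n) := by
  have hrange : Set.range (Subtype.val : coordHyperplane i → Euc n) = {z : Euc n | z i = 0} := by
    ext z
    simp [mem_coordHyperplane]
  have hiso : Isometry (Subtype.val : coordHyperplane i → Euc n) := isometry_subtype_coe
  have hmap := hiso.map_hausdorffMeasure (d := (n : ℝ) - 1) (Or.inl (by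
    rw [← finrank_coordHyperplane i]; positivity))
  have hemb : MeasurableEmbedding (Subtype.val : coordHyperplane i → Euc n) :=
    MeasurableEmbedding.subtype_coe (coordHyperplane i).closed_of_finiteDimensional.measurableSet
  unfold IntegrableOn surf
  rw [← hrange, ← hmap, hemb.integrable_map_iff, ← finrank_coordHyperplane i]
  refine (integrable_rpow_neg_one_add_norm_sq (E := coordHyperplane i)
    (μ := μH[(Module.finrank ℝ (coordHyperplane i) : ℝ)]) (r := s)
    (by rwa [finrank_coordHyperplane])).congr (Eventually.of_forall fun y => ?_)
  have h0 : (y : Euc n) i = 0 := (mem_coordHyperplane i).1 y.2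
  have h1 := norm_sub_single_sq i (y : Euc n)
  rw [h0] at h1
  have h2 : (1 : ℝ) + ‖y‖ ^ 2 = ‖(y : Euc n) - EuclideanSpace.single i 1‖ ^ 2 := by
    rw [h1, Submodule.coe_norm]
    ring
  simp only [Function.comp]
  rw [h2, ← Real.rpow_natCast, ← Real.rpow_mul (norm_nonneg _)]
  congr 1
  push_cast
  ring

lemma one_le_norm_sub_single {z : Euc n} (hz : z i = 0) :
    1 ≤ ‖z - EuclideanSpace.single i 1‖ := by
  have h := norm_sub_single_sq i z
  rw [hz] at h
  nlinarith [norm_nonneg (z - EuclideanSpace.single i 1), sq_nonneg ‖z‖]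

lemma measurableSet_coord_eq_zero : MeasurableSet {z : Euc n | z i = 0} :=
  measurableSet_eq_fun (by fun_prop) measurable_const

lemma continuousOn_integral_hyperplane_rpow {s₀ : ℝ} (hs₀ : (n : ℝ) - 1 < s₀) {s : ℝ → ℝ}
    (hs : Continuous s) {S : Set ℝ} (hS : ∀ p ∈ S, s₀ ≤ s p) :
    ContinuousOn (fun p => ∫ y in {z : Euc n | z i = 0},
      ‖y - EuclideanSpace.single i 1‖ ^ (-(s p)) ∂(surf n)) S := by
  intro p _
  refine continuousWithinAt_of_dominated
    (bound := fun y => ‖y - EuclideanSpace.single i 1‖ ^ (-s₀)) ?_ ?_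
    (integrableOn_hyperplane_rpow i hs₀) ?_
  · refine Eventually.of_forall fun q => Measurable.aestronglyMeasurable ?_
    fun_prop
  · filter_upwards [self_mem_nhdsWithin] with q hq
    filter_upwards [ae_restrict_mem (measurableSet_coord_eq_zero i)] with y hy
    rw [Real.norm_eq_abs, abs_of_nonneg (by positivity)]
    exact Real.rpow_le_rpow_of_exponent_le (one_le_norm_sub_single i hy)
      (neg_le_neg (hS q hq))
  · filter_upwards [ae_restrict_mem (measurableSet_coord_eq_zero i)] with y hy
    have h := one_le_norm_sub_single i hy
    exact (continuous_const.rpow hs.neg fun _ => Or.inl (by linarith)).continuousWithinAt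

/-- The integrand over the half-space, as a function of `p` and `z`. -/
def halfSpaceIntegrand (p : ℝ) (z : Euc n) : ℝ :=
  ((1 - z i) * ‖z - EuclideanSpace.single i 1‖ ^ (-(n : ℝ))
    - (1 + z i) * ‖z + EuclideanSpace.single i 1‖ ^ (-(n : ℝ)))
  * ((‖z - EuclideanSpace.single i 1‖ ^ ((2 : ℝ) - n)
        - ‖z + EuclideanSpace.single i 1‖ ^ ((2 : ℝ) - n)) ^ p
      - ‖z - EuclideanSpace.single i 1‖ ^ (-(((n : ℝ) - 2) * p)))

lemma measurable_halfSpaceIntegrand (p : ℝ) : Measurable (halfSpaceIntegrand i p) := by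
  unfold halfSpaceIntegrand
  fun_prop

lemma norm_sub_single_le_norm_add_single {z : Euc n} (hz : 0 < z i) :
    ‖z - EuclideanSpace.single i 1‖ ≤ ‖z + EuclideanSpace.single i 1‖ := by
  refine le_of_sq_le_sq ?_ (norm_nonneg _)
  rw [norm_sub_single_sq, norm_add_single_sq]
  linarith

lemma abs_halfSpaceIntegrand_le (hn : 5 ≤ n) {p p₁ : ℝ} (hp : 1 ≤ p) (hpp : p ≤ p₁)
    {z : Euc n} (hz : 0 < z i) (hz' : z ≠ EuclideanSpace.single i 1) :
    |halfSpaceIntegrand i p z| ≤ radialMajorant n p₁ ‖z - EuclideanSpace.single i 1‖ := by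
  have ha := PiLp.norm_apply_le (z - EuclideanSpace.single i (1 : ℝ)) i
  have hb := PiLp.norm_apply_le (z + EuclideanSpace.single i (1 : ℝ)) i
  simp only [PiLp.sub_apply, PiLp.add_apply, PiLp.single_apply, if_true, Real.norm_eq_abs]
    at ha hb
  rw [abs_sub_comm] at ha
  rw [add_comm] at hb
  refine abs_integrand_le_radialMajorant (by exact_mod_cast hn) (norm_pos_iff.2 (sub_ne_zero.2 hz'))
    (norm_sub_single_le_norm_add_single i hz) ?_ ha hb hp hpp
  have := le_abs_self (1 + z i)
  linarith

lemma ae_halfSpace : ∀ᵐ z ∂((volume : Measure (Euc n)).restrict {z | 0 < z i}),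
    0 < z i ∧ z ≠ EuclideanSpace.single i 1 := by
  have : Nonempty (Fin n) := ⟨i⟩
  filter_upwards [ae_restrict_mem
    (measurableSet_lt measurable_const (by fun_prop : Measurable fun z : Euc n => z i)),
    ae_restrict_of_ae (Measure.ae_ne volume (EuclideanSpace.single i (1 : ℝ)))] with z h1 h2
  exact ⟨h1, h2⟩

lemma integrableOn_radialMajorant (hn : 5 ≤ n) {p₁ : ℝ}
    (hp₁ : ((n : ℝ) - 2) * p₁ < (n : ℝ) - 1) :
    IntegrableOn (fun z : Euc n => radialMajorant n p₁ ‖z - EuclideanSpace.single i 1‖)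
      {z | 0 < z i} :=
  ((integrable_radialMajorant_norm hn hp₁).comp_sub_right
    (EuclideanSpace.single i 1)).integrableOn

lemma integrableOn_halfSpaceIntegrand (hn : 5 ≤ n) {p : ℝ} (hp : 1 ≤ p)
    (hp' : ((n : ℝ) - 2) * p < (n : ℝ) - 1) :
    IntegrableOn (halfSpaceIntegrand i p) {z | 0 < z i} := by
  refine (integrableOn_radialMajorant i hn hp').mono'
    (measurable_halfSpaceIntegrand i p).aestronglyMeasurable ?_
  filter_upwards [ae_halfSpace i] with z hz
  exact abs_halfSpaceIntegrand_le i hn hp le_rfl hz.1 hz.2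

lemma continuousOn_integral_halfSpaceIntegrand (hn : 5 ≤ n) :
    ContinuousOn (fun p => ∫ z in {z : Euc n | 0 < z i}, halfSpaceIntegrand i p z)
      (Set.Ico (1 : ℝ) (((n : ℝ) - 1) / ((n : ℝ) - 2))) := by
  intro p hp
  have hn' : (5 : ℝ) ≤ n := by exact_mod_cast hn
  obtain ⟨p₁, hpp, hp₁⟩ := exists_between hp.2
  rw [lt_div_iff₀ (by linarith), mul_comm] at hp₁
  refine continuousWithinAt_of_dominated
    (bound := fun z => radialMajorant n p₁ ‖z - EuclideanSpace.single i 1‖) ?_ ?_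
    (integrableOn_radialMajorant i hn hp₁) ?_
  · exact Eventually.of_forall fun q => (measurable_halfSpaceIntegrand i q).aestronglyMeasurable
  · filter_upwards [self_mem_nhdsWithin, mem_nhdsWithin_of_mem_nhds (Iio_mem_nhds hpp)]
      with q hq hq'
    filter_upwards [ae_halfSpace i] with z hz
    exact abs_halfSpaceIntegrand_le i hn hq.1 (le_of_lt hq') hz.1 hz.2
  · filter_upwards [ae_halfSpace i] with z hz
    have ha : ‖z - EuclideanSpace.single i (1 : ℝ)‖ ≠ 0 := norm_ne_zero_iff.2 (sub_ne_zero.2 hz.2)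
    have hp0 : 0 < p := by linarith [hp.1]
    unfold halfSpaceIntegrand
    refine ContinuousAt.continuousWithinAt (continuousAt_const.mul (ContinuousAt.sub ?_ ?_))
    · exact continuousAt_const.rpow continuousAt_id (Or.inr hp0)
    · exact continuousAt_const.rpow (by fun_prop) (Or.inl ha)

end Hyperplane

/-- The two quantities entering the nondegeneracy condition (A1) are well defined and depend
continuously on `p ∈ [1, (n-1)/(n-2))`. -/
theorem continuity_in_p_of_A1_integrals
    (n : ℕ) (hn : 5 ≤ n) (i : Fin n) (hi : (i : ℕ) = n - 1)
    (F G : ℝ → ℝ)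
    (hF : ∀ p : ℝ, F p =
      ∫ z in {z : Euc n | 0 < z i},
        ((1 - z i) * ‖z - EuclideanSpace.single i 1‖ ^ (-(n : ℝ))
          - (1 + z i) * ‖z + EuclideanSpace.single i 1‖ ^ (-(n : ℝ)))
        * ((‖z - EuclideanSpace.single i 1‖ ^ ((2 : ℝ) - n)
              - ‖z + EuclideanSpace.single i 1‖ ^ ((2 : ℝ) - n)) ^ p
            - ‖z - EuclideanSpace.single i 1‖ ^ (-(((n : ℝ) - 2) * p))))
    (hG : ∀ p : ℝ, G p =
      (2 * ((n : ℝ) - 2) / ((((n : ℝ) - 2) * p - 2) * ((n : ℝ) - ((n : ℝ) - 2) * p))) *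
        ((∫ y in {z : Euc n | z i = 0},
            ‖y - EuclideanSpace.single i 1‖ ^ (-(((n : ℝ) - 2) * (p + 1))) ∂(surf n))
          - (n : ℝ) *
            ∫ y in {z : Euc n | z i = 0},
              ‖y - EuclideanSpace.single i 1‖ ^ (-(((n : ℝ) - 2) * p + n)) ∂(surf n))) :
    (∀ p ∈ Set.Ico (1 : ℝ) (((n : ℝ) - 1) / ((n : ℝ) - 2)),
      IntegrableOn (fun z : Euc n =>
          ((1 - z i) * ‖z - EuclideanSpace.single i 1‖ ^ (-(n : ℝ))
            - (1 + z i) * ‖z + EuclideanSpace.single i 1‖ ^ (-(n : ℝ)))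
          * ((‖z - EuclideanSpace.single i 1‖ ^ ((2 : ℝ) - n)
                - ‖z + EuclideanSpace.single i 1‖ ^ ((2 : ℝ) - n)) ^ p
              - ‖z - EuclideanSpace.single i 1‖ ^ (-(((n : ℝ) - 2) * p))))
        {z : Euc n | 0 < z i} volume ∧
      IntegrableOn (fun y : Euc n =>
          ‖y - EuclideanSpace.single i 1‖ ^ (-(((n : ℝ) - 2) * (p + 1))))
        {z : Euc n | z i = 0} (surf n) ∧
      IntegrableOn (fun y : Euc n =>
          ‖y - EuclideanSpace.single i 1‖ ^ (-(((n : ℝ) - 2) * p + n)))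
        {z : Euc n | z i = 0} (surf n)) ∧
    ContinuousOn F (Set.Ico (1 : ℝ) (((n : ℝ) - 1) / ((n : ℝ) - 2))) ∧
    ContinuousOn G (Set.Ico (1 : ℝ) (((n : ℝ) - 1) / ((n : ℝ) - 2))) := by
  have hn' : (5 : ℝ) ≤ n := by exact_mod_cast hn
  have hmul : ∀ p ∈ Set.Ico (1 : ℝ) (((n : ℝ) - 1) / ((n : ℝ) - 2)),
      (n : ℝ) - 2 ≤ ((n : ℝ) - 2) * p ∧ ((n : ℝ) - 2) * p < (n : ℝ) - 1 := by
    intro p hp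
    have h := hp.2
    rw [lt_div_iff₀ (by linarith), mul_comm] at h
    exact ⟨by nlinarith [hp.1], h⟩
  refine ⟨fun p hp => ⟨integrableOn_halfSpaceIntegrand i hn hp.1 (hmul p hp).2,
    integrableOn_hyperplane_rpow i ?_, integrableOn_hyperplane_rpow i ?_⟩, ?_, ?_⟩
  · linarith [hmul p hp]
  · linarith [hmul p hp]
  · exact (continuousOn_integral_halfSpaceIntegrand i hn).congr fun p _ => hF p
  · have hs₀ : (n : ℝ) - 1 < 2 * ((n : ℝ) - 2) := by linarith
    refine ContinuousOn.congr (ContinuousOn.mul ?_ (ContinuousOn.sub ?_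
      (continuousOn_const.mul ?_))) fun p _ => hG p
    · refine continuousOn_const.div (by fun_prop) fun p hp => mul_ne_zero ?_ ?_
      · linarith [hmul p hp]
      · linarith [hmul p hp]
    · exact continuousOn_integral_hyperplane_rpow i hs₀ (by fun_prop) fun p hp => by
        linarith [hmul p hp]
    · exact continuousOn_integral_hyperplane_rpow i hs₀ (by fun_prop) fun p hp => by
        linarith [hmul p hp]
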